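/- The following are equivalent: (1) R is an Arf ring (every integrally closed regular ideal of R is stable); (2) every reflexive regular ideal I of R with C ⊆ I ⊆ R is integrally closed; (3) every reflexive fractional ideal of R is isomorphic to an integrally closed ideal I of R with C ⊆ I ⊆ R. -/

import Mathlib

open scoped nonZeroDivisors

noncomputable section

/-- `x ∈ R` is integral over the ideal `I`: it satisfies an equation of integral
dependence over `I`, i.e. a monic polynomial whose coefficient in degree
`deg - i` lies in `I ^ i`. -/
def IsIntegralOverIdeal {R : Type*} [CommRing R] (I : Ideal R) (x : R) : Prop :=
  ∃ p : Polynomial R, p.Monic ∧ (∀ i < p.natDegree, p.coeff i ∈ I ^ (p.natDegree - i)) ∧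
    Polynomial.eval x p = 0

/-- The integral closure of the ideal `I`, viewed as an `R`-submodule of `Q(R)`. -/
def intCl (R : Type*) [CommRing R] (I : Ideal R) : Submodule R (FractionRing R) :=
  Submodule.span R (algebraMap R (FractionRing R) '' {r : R | IsIntegralOverIdeal I r})

/-- `J` is a reduction of `I`: `J ⊆ I` and `J I^n = I^(n+1)` for some `n`. -/
def IsIdealReduction {R : Type*} [CommRing R] (J I : Ideal R) : Prop :=
  J ≤ I ∧ ∃ n : ℕ, J * I ^ n = I ^ (n + 1)

/-- `J` is a minimal reduction of `I`: no reduction of `I` is properly contained in `J`. -/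
def IsMinimalReduction {R : Type*} [CommRing R] (J I : Ideal R) : Prop :=
  IsIdealReduction J I ∧ ∀ K : Ideal R, IsIdealReduction K I → K ≤ J → K = J

/-- The ideal `I` of `R`, viewed as an `R`-submodule of `Q(R)`. -/
def idl (R : Type*) [CommRing R] (I : Ideal R) : Submodule R (FractionRing R) :=
  Submodule.map (Algebra.linearMap R (FractionRing R)) I

/-- The integral closure `R̄` of `R` in `Q(R)`, as an `R`-submodule of `Q(R)`. -/
def Rbar (R : Type*) [CommRing R] : Submodule R (FractionRing R) :=
  Subalgebra.toSubmodule (integralClosure R (FractionRing R))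

/-- The condC `C = R : R̄`, as an `R`-submodule of `Q(R)`. -/
def condC (R : Type*) [CommRing R] : Submodule R (FractionRing R) :=
  1 / Rbar R

/-- The product `z • I` of a submodule `I` of `Q(R)` by an element `z ∈ Q(R)`. -/
def smulQ {R : Type*} [CommRing R] (z : FractionRing R)
    (I : Submodule R (FractionRing R)) : Submodule R (FractionRing R) :=
  Submodule.span R {z} * I

/-- `I` is a (regular) fractional ideal of `R`: it contains a regular
(= invertible) element of `Q(R)`, and `yI ⊆ R` for some regular `y ∈ R`. -/
def IsFracIdeal {R : Type*} [CommRing R] (I : Submodule R (FractionRing R)) : Prop :=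
  (∃ u : (FractionRing R)ˣ, (u : FractionRing R) ∈ I) ∧
    ∃ y ∈ R⁰, smulQ (algebraMap R (FractionRing R) y) I ≤ 1

/-- `z ∈ Q(R)` is a reduction of the fractional ideal `F`: `z = x/y` with `y`
regular in `R`, `yF ⊆ R`, and `(x)` a minimal reduction of the ideal `yF` of `R`. -/
def IsFracReduction {R : Type*} [CommRing R] (z : FractionRing R)
    (F : Submodule R (FractionRing R)) : Prop :=
  ∃ x y : R, y ∈ R⁰ ∧
    z * algebraMap R (FractionRing R) y = algebraMap R (FractionRing R) x ∧
    smulQ (algebraMap R (FractionRing R) y) F ≤ 1 ∧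
    IsMinimalReduction (Ideal.span {x})
      (Submodule.comap (Algebra.linearMap R (FractionRing R))
        (smulQ (algebraMap R (FractionRing R) y) F))

theorem isIntegral_of_mul_mem {S Q : Type*} [CommRing S] [IsNoetherianRing S] [CommRing Q]
    [Algebra S Q] (N : Submodule S Q) (hN : N.FG) (u : Qˣ) (hu : (u : Q) ∈ N) (q : Q)
    (hq : ∀ n ∈ N, q * n ∈ N) : IsIntegral S q := by
  have hle : Subalgebra.toSubmodule (Algebra.adjoin S {q}) ≤
      N.map (LinearMap.mulLeft S ((u⁻¹ : Qˣ) : Q)) := by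
    intro z hz
    have key : ∀ n ∈ N, z * n ∈ N := by
      have hz' : z ∈ Algebra.adjoin S {q} := hz
      induction hz' using Algebra.adjoin_induction with
      | mem x hx => rw [Set.mem_singleton_iff.mp hx]; exact hq
      | algebraMap r => intro n hn; rw [← Algebra.smul_def]; exact N.smul_mem r hn
      | add x y _ _ hx hy =>
        intro n hn; rw [add_mul]; exact N.add_mem (hx ‹_› n hn) (hy ‹_› n hn)
      | mul x y _ _ hx hy => intro n hn; rw [mul_assoc]; exact hx ‹_› _ (hy ‹_› n hn)
    exact ⟨z * u, key _ hu, by simp [mul_comm z]⟩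
  have : IsNoetherian S (N.map (LinearMap.mulLeft S ((u⁻¹ : Qˣ) : Q))) :=
    isNoetherian_of_fg_of_noetherian _ (hN.map _)
  exact isIntegral_of_submodule_noetherian _ (isNoetherian_of_le hle) q
    (Algebra.subset_adjoin rfl)

theorem exists_mul_le_one_of_isMaximal {S Q : Type*} [CommRing S] [IsNoetherianRing S]
    [CommRing Q] [Algebra S Q] (hinj : Function.Injective (algebraMap S Q))
    (hmax : ∀ P : Ideal S, P.IsPrime → (∃ a ∈ P, IsUnit (algebraMap S Q a)) → P.IsMaximal)
    (P : Ideal S) (hP : P.IsMaximal) (a : S) (haP : a ∈ P) (ha : IsUnit (algebraMap S Q a)) :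
    ∃ f : Q, (∀ p ∈ P, ∃ s, algebraMap S Q s = f * algebraMap S Q p) ∧
      ¬ ∃ s, algebraMap S Q s = f := by
  have hmin : P ∈ (Ideal.span {a}).minimalPrimes := by
    refine ⟨⟨hP.isPrime, by simpa [Ideal.span_le] using haP⟩, fun P' ⟨h1, h2⟩ h3 => ?_⟩
    have : P'.IsMaximal := hmax P' h1 ⟨a, h2 (Ideal.mem_span_singleton_self a), ha⟩
    exact (this.eq_of_le hP.ne_top h3).ge
  have hass : P ∈ associatedPrimes S (S ⧸ Ideal.span {a}) := by
    apply Module.associatedPrimes.minimalPrimes_annihilator_subset_associatedPrimes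
    rwa [Ideal.annihilator_quotient]
  obtain ⟨hprime, x, hx⟩ := (isAssociatedPrime_iff).1 hass
  obtain ⟨b, rfl⟩ := Ideal.Quotient.mk_surjective x
  have hmem : ∀ p : S, p ∈ P ↔ a ∣ p * b := by
    intro p
    rw [hx]
    simp [Submodule.mem_colon_singleton, Algebra.smul_def, ← map_mul,
      Ideal.Quotient.eq_zero_iff_mem, Ideal.mem_span_singleton]
  obtain ⟨u, hu⟩ := ha
  refine ⟨((u⁻¹ : Qˣ) : Q) * algebraMap S Q b, ?_, ?_⟩
  · intro p hp
    obtain ⟨c, hc⟩ := (hmem p).1 hp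
    refine ⟨c, ?_⟩
    rw [mul_assoc, ← map_mul, mul_comm b, hc, map_mul, ← hu, Units.inv_mul_cancel_left]
  · rintro ⟨s, hs⟩
    have h1 : b = a * s := hinj (by rw [map_mul, hs, ← hu, Units.mul_inv_cancel_left])
    apply hP.ne_top
    rw [Ideal.eq_top_iff_one, hmem]
    exact ⟨s, by rw [one_mul, h1]⟩

theorem exists_map_mul_eq_one {S Q : Type*} [CommRing S] [IsNoetherianRing S]
    [CommRing Q] [Algebra S Q] (hinj : Function.Injective (algebraMap S Q))
    (hcl : ∀ q : Q, IsIntegral S q → ∃ s, algebraMap S Q s = q)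
    (hmax : ∀ P : Ideal S, P.IsPrime → (∃ a ∈ P, IsUnit (algebraMap S Q a)) → P.IsMaximal)
    (A : Ideal S) (hA : ∃ a ∈ A, IsUnit (algebraMap S Q a)) :
    ∃ N : Submodule S Q, Submodule.map (Algebra.linearMap S Q) A * N = 1 := by
  induction A using WellFoundedGT.induction with
  | ind A ih =>
  obtain ⟨a, haA, ha⟩ := hA
  by_cases htop : A = ⊤
  · refine ⟨1, ?_⟩
    rw [htop, mul_one, Submodule.map_top, Submodule.one_eq_range]
  obtain ⟨P, hP, hAP⟩ := Ideal.exists_le_maximal A htop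
  obtain ⟨f, hf, hfS⟩ := exists_mul_le_one_of_isMaximal hinj hmax P hP a (hAP haA) ha
  set N : Submodule S Q := 1 ⊔ Submodule.span S {f} with hN
  have hle : Submodule.map (Algebra.linearMap S Q) A * N ≤ 1 := by
    rw [hN, Submodule.mul_sup, mul_one, sup_le_iff]
    constructor
    · rw [Submodule.one_eq_range]; exact LinearMap.map_le_range
    · rw [Submodule.mul_le]
      rintro _ ⟨m, hm, rfl⟩ n hn
      obtain ⟨c, rfl⟩ := Submodule.mem_span_singleton.1 hn
      obtain ⟨s, hs⟩ := hf m (hAP hm)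
      refine Submodule.mem_one.2 ⟨c * s, ?_⟩
      rw [map_mul, hs, Algebra.smul_def, Algebra.linearMap_apply]; ring
  set B : Ideal S := Submodule.comap (Algebra.linearMap S Q)
    (Submodule.map (Algebra.linearMap S Q) A * N) with hB
  have hmapB : Submodule.map (Algebra.linearMap S Q) B =
      Submodule.map (Algebra.linearMap S Q) A * N := by
    rw [hB, Submodule.map_comap_eq, ← Submodule.one_eq_range]
    exact inf_eq_right.2 hle
  have hAN : Submodule.map (Algebra.linearMap S Q) A ≤
      Submodule.map (Algebra.linearMap S Q) A * N := by
    rw [hN, Submodule.mul_sup, mul_one]; exact le_sup_left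
  have hAB : A ≤ B := Submodule.map_le_iff_le_comap.1 hAN
  have hne : A ≠ B := by
    intro h
    apply hfS
    apply hcl
    obtain ⟨u, hu⟩ := ha
    refine isIntegral_of_mul_mem (Submodule.map (Algebra.linearMap S Q) A)
      ((IsNoetherian.noetherian A).map _) u ⟨a, haA, hu.symm⟩ f fun n hn => ?_
    rw [← h] at hmapB
    rw [hmapB, mul_comm f]
    exact Submodule.mul_mem_mul hn
      (Submodule.mem_sup_right (Submodule.mem_span_singleton_self f))
  obtain ⟨N', hN'⟩ := ih B (lt_of_le_of_ne hAB hne) ⟨a, hAB haA, ha⟩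
  exact ⟨N * N', by rw [← mul_assoc, ← hmapB, hN']⟩

theorem not_finiteIndex_of_ne_top {R M : Type*} [CommRing R] [IsLocalRing R]
    [Infinite (IsLocalRing.ResidueField R)] [AddCommGroup M] [Module R M]
    (p : Submodule R M) (hp : p ≠ ⊤) : ¬ p.toAddSubgroup.FiniteIndex := by
  intro h
  obtain ⟨m, hm⟩ : ∃ m, m ∉ p := by
    by_contra! h'; exact hp (eq_top_iff.2 fun x _ => h' x)
  have hfin : Finite (M ⧸ p) := p.toAddSubgroup.finite_quotient_of_finiteIndex
  obtain ⟨x, y, hxy, heq⟩ := Finite.exists_ne_map_eq_of_infinite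
    (fun x : IsLocalRing.ResidueField R =>
      p.mkQ (Function.surjInv (IsLocalRing.residue_surjective (R := R)) x • m))
  set r := Function.surjInv (IsLocalRing.residue_surjective (R := R)) x with hr
  set s := Function.surjInv (IsLocalRing.residue_surjective (R := R)) y with hs
  have h1 : (r - s) • m ∈ p := by
    have : p.mkQ (r • m) = p.mkQ (s • m) := heq
    rw [sub_smul]
    exact (Submodule.Quotient.eq p).1 this
  have h2 : IsUnit (r - s) := by
    rw [← IsLocalRing.residue_ne_zero_iff_isUnit, map_sub, hr, hs,
      Function.surjInv_eq IsLocalRing.residue_surjective,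
      Function.surjInv_eq IsLocalRing.residue_surjective]
    exact sub_ne_zero.2 hxy
  exact hm ((Submodule.smul_mem_iff_of_isUnit p h2).1 h1)

theorem exists_algebraMap_eq_of_isUnit {R : Type*} [CommRing R] (u : (FractionRing R)ˣ) :
    ∃ r ∈ R⁰, ∃ t ∈ R⁰, (u : FractionRing R) * algebraMap R (FractionRing R) t =
      algebraMap R (FractionRing R) r := by
  obtain ⟨⟨r, t⟩, h⟩ := IsLocalization.surj R⁰ (u : FractionRing R)
  refine ⟨r, ?_, t, t.2, h⟩
  refine mem_nonZeroDivisors_of_injective (IsFractionRing.injective R (FractionRing R)) ?_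
  rw [← h]
  exact (u.isUnit.mul (IsLocalization.map_units _ t)).mem_nonZeroDivisors

theorem smulQ_le_one_iff {R : Type*} [CommRing R] (z : FractionRing R)
    (M : Submodule R (FractionRing R)) :
    smulQ z M ≤ 1 ↔ ∀ m ∈ M, ∃ r, algebraMap R (FractionRing R) r = z * m := by
  simp only [smulQ, SetLike.le_def, Submodule.mem_span_singleton_mul, Submodule.mem_one]
  exact ⟨fun h m hm => h ⟨m, hm, rfl⟩, fun h _ ⟨m, hm, e⟩ => e ▸ h m hm⟩

theorem isMaximal_of_exists_isUnit_mem {R : Type*} [CommRing R] [IsNoetherianRing R]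
    [IsLocalRing R] (hdim : ringKrullDim R = 1)
    (P : Ideal (integralClosure R (FractionRing R))) (hP : P.IsPrime)
    (hu : ∃ a ∈ P, IsUnit (algebraMap (integralClosure R (FractionRing R)) (FractionRing R) a)) :
    P.IsMaximal := by
  obtain ⟨a, haP, u, hu⟩ := hu
  obtain ⟨r, hr, t, ht, h⟩ := exists_algebraMap_eq_of_isUnit u
  have hrP : r ∈ P.comap (algebraMap R (integralClosure R (FractionRing R))) := by
    rw [Ideal.mem_comap]
    have : algebraMap R (integralClosure R (FractionRing R)) r =
        a * algebraMap R (integralClosure R (FractionRing R)) t := by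
      apply Subtype.ext
      change algebraMap R (FractionRing R) r = (a : FractionRing R) * algebraMap R _ t
      rw [← h, hu]; rfl
    rw [this]
    exact P.mul_mem_right _ haP
  have hk : Ring.KrullDimLE 1 R := by
    rw [Ring.KrullDimLE, Order.krullDimLE_iff]; exact hdim.le
  have hmax := (Ring.krullDimLE_one_iff.1 hk
    (P.comap (algebraMap R (integralClosure R (FractionRing R)))) inferInstance).resolve_left
    fun hmin => notMem_nonZeroDivisors_of_mem_mem_minimalPrimes hrP hmin hr
  exact Ideal.isMaximal_of_isIntegral_of_isMaximal_comap P hmax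

/-- Over a local ring with infinite residue field and finite normalization, every fractional
ideal contains an invertible element generating its extension to the normalization. -/
theorem exists_unit_mem_forall_isIntegral {R : Type*} [CommRing R] [IsNoetherianRing R]
    [IsLocalRing R] (hdim : ringKrullDim R = 1) [Infinite (IsLocalRing.ResidueField R)]
    (hfin : (Subalgebra.toSubmodule (integralClosure R (FractionRing R))).FG)
    (M : Submodule R (FractionRing R)) (hM : IsFracIdeal M) :
    ∃ x : (FractionRing R)ˣ, (x : FractionRing R) ∈ M ∧
      ∀ m ∈ M, IsIntegral R (((x⁻¹ : (FractionRing R)ˣ) : FractionRing R) * m) := by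
  set Q := FractionRing R
  set S := integralClosure R Q with hS
  have : Module.Finite R S := Module.Finite.iff_fg.2 hfin
  have : IsNoetherianRing S := IsNoetherianRing.of_finite R S
  have hinj : Function.Injective (algebraMap S Q) := Subtype.val_injective
  have hmaxfin : Finite (MaximalSpectrum S) := by
    have h := Algebra.QuasiFinite.finite_primesOver (S := S) (IsLocalRing.maximalIdeal R)
    have : Finite ((IsLocalRing.maximalIdeal R).primesOver S) := h
    refine Finite.of_injective
      (fun P : MaximalSpectrum S => (⟨P.asIdeal, P.isMaximal.isPrime, ⟨?_⟩⟩ :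
        (IsLocalRing.maximalIdeal R).primesOver S)) ?_
    · have := P.isMaximal
      exact (IsLocalRing.eq_maximalIdeal
        (Ideal.isMaximal_comap_of_isIntegral_of_isMaximal P.asIdeal)).symm
    · intro P P' h
      exact MaximalSpectrum.ext (congrArg Subtype.val h)
  obtain ⟨⟨u, hu⟩, y, hy, hyM⟩ := hM
  rw [smulQ_le_one_iff] at hyM
  have hyu : IsUnit (algebraMap R Q y) := IsLocalization.map_units Q ⟨y, hy⟩
  have hyS : ∀ m ∈ M, ∃ s : S, (s : Q) = algebraMap R Q y * m := fun m hm => by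
    obtain ⟨r, hr⟩ := hyM m hm
    exact ⟨algebraMap R S r, hr⟩
  set A : Ideal S := Ideal.span {s : S | ∃ m ∈ M, (s : Q) = algebraMap R Q y * m} with hA
  obtain ⟨N, hN⟩ := exists_map_mul_eq_one hinj
    (fun q hq => ⟨⟨q, isIntegral_trans q hq⟩, rfl⟩)
    (isMaximal_of_exists_isUnit_mem hdim) A (by
      obtain ⟨s, hs⟩ := hyS u hu
      exact ⟨s, Ideal.subset_span ⟨u, hu, hs⟩, by
        change IsUnit (s : Q)
        rw [hs]; exact hyu.mul u.isUnit⟩)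
  have hMN : ∀ m ∈ M, ∀ n ∈ N, ∃ s : S, (s : Q) = algebraMap R Q y * m * n := by
    intro m hm n hn
    obtain ⟨s, hs⟩ := hyS m hm
    have : (s : Q) * n ∈ Submodule.map (Algebra.linearMap S Q) A * N :=
      Submodule.mul_mem_mul ⟨s, Ideal.subset_span ⟨m, hm, hs⟩, rfl⟩ hn
    rw [hN, Submodule.mem_one] at this
    obtain ⟨t, ht⟩ := this
    exact ⟨t, by rw [← hs]; exact ht⟩
  let p : MaximalSpectrum S → Submodule R M := fun P =>
    { carrier := {m | ∀ n ∈ N, ∃ s ∈ P.asIdeal, (s : Q) = algebraMap R Q y * m * n}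
      zero_mem' := fun n _ => ⟨0, P.asIdeal.zero_mem, by simp⟩
      add_mem' := by
        intro m m' h h' n hn
        obtain ⟨s, hs, e⟩ := h n hn
        obtain ⟨s', hs', e'⟩ := h' n hn
        refine ⟨s + s', P.asIdeal.add_mem hs hs', ?_⟩
        push_cast
        rw [e, e']; ring
      smul_mem' := by
        intro r m h n hn
        obtain ⟨s, hs, e⟩ := h n hn
        refine ⟨r • s, Submodule.smul_of_tower_mem P.asIdeal r hs, ?_⟩
        change r • (s : Q) = algebraMap R Q y * (r • (m : Q)) * n
        rw [e, Algebra.smul_def, Algebra.smul_def]; ring }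
  have hp : ∀ P, p P ≠ ⊤ := by
    intro P htop
    have hle : Submodule.map (Algebra.linearMap S Q) A * N ≤
        Submodule.map (Algebra.linearMap S Q) P.asIdeal := by
      rw [Submodule.mul_le]
      rintro _ ⟨a, ha, rfl⟩ n hn
      rw [hA] at ha
      induction ha using Submodule.span_induction with
      | mem x hx =>
        obtain ⟨m, hm, e⟩ := hx
        have h1 : (⟨m, hm⟩ : M) ∈ p P := by rw [htop]; trivial
        obtain ⟨s, hs, e'⟩ := h1 n hn
        refine ⟨s, hs, ?_⟩
        change (s : Q) = (x : Q) * n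
        rw [e', e]
      | zero => simp
      | add x z _ _ h1 h2 => rw [map_add, add_mul]; exact Submodule.add_mem _ h1 h2
      | smul r x _ h1 =>
        rw [map_smul, smul_mul_assoc]; exact Submodule.smul_mem _ _ h1
    rw [hN] at hle
    obtain ⟨s, hs, e⟩ := hle (Submodule.mem_one.2 ⟨1, map_one _⟩ : (1 : Q) ∈ _)
    have : s = 1 := hinj (by rw [map_one]; exact e)
    exact P.isMaximal.ne_top ((Ideal.eq_top_iff_one _).2 (this ▸ hs))
  have := Fintype.ofFinite (MaximalSpectrum S)
  obtain ⟨m, hm⟩ : ∃ m : M, ∀ P, m ∉ p P := by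
    by_contra! hcov
    obtain ⟨P, -, hP⟩ := Submodule.exists_finiteIndex_of_cover (p := p) (s := Finset.univ)
      (Set.eq_univ_of_forall fun m => by simpa using hcov m)
    exact not_finiteIndex_of_ne_top _ (hp P) hP
  have hone : ∃ n ∈ N, algebraMap R Q y * m * n = 1 := by
    let K : Ideal S := Submodule.comap (Algebra.linearMap S Q)
      (Submodule.map (LinearMap.mulLeft S (algebraMap R Q y * m)) N)
    have hK : K = ⊤ := by
      by_contra hK
      obtain ⟨P, hP, hKP⟩ := Ideal.exists_le_maximal K hK
      refine hm ⟨P, hP⟩ fun n hn => ?_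
      obtain ⟨s, hs⟩ := hMN m m.2 n hn
      exact ⟨s, hKP ⟨n, hn, hs.symm⟩, hs⟩
    obtain ⟨n, hn, e⟩ := (Ideal.eq_top_iff_one K).1 hK
    exact ⟨n, hn, e⟩
  obtain ⟨n, hn, e⟩ := hone
  refine ⟨⟨m, algebraMap R Q y * n, by rw [← e]; ring, by rw [← e]; ring⟩, m.2, ?_⟩
  intro m' hm'
  obtain ⟨s, hs⟩ := hMN m' hm' n hn
  change IsIntegral R (algebraMap R Q y * n * m')
  rw [mul_right_comm, ← hs]
  exact s.2

theorem mem_idl {R : Type*} [CommRing R] {I : Ideal R} {q : FractionRing R} :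
    q ∈ idl R I ↔ ∃ r ∈ I, algebraMap R (FractionRing R) r = q := Iff.rfl

theorem algebraMap_mem_idl {R : Type*} [CommRing R] {I : Ideal R} {r : R} :
    algebraMap R (FractionRing R) r ∈ idl R I ↔ r ∈ I := by
  refine ⟨fun ⟨s, hs, h⟩ => ?_, fun h => ⟨r, h, rfl⟩⟩
  rwa [← IsFractionRing.injective R (FractionRing R) h]

theorem mem_smulQ {R : Type*} [CommRing R] {z q : FractionRing R}
    {M : Submodule R (FractionRing R)} : q ∈ smulQ z M ↔ ∃ m ∈ M, z * m = q :=
  Submodule.mem_span_singleton_mul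

theorem mem_one_div {R : Type*} [CommRing R] {M : Submodule R (FractionRing R)}
    {q : FractionRing R} :
    q ∈ 1 / M ↔ ∀ m ∈ M, ∃ r, algebraMap R (FractionRing R) r = q * m := by
  simp only [Submodule.mem_div_iff_forall_mul_mem, Submodule.mem_one]

theorem isFracIdeal_one_div {R : Type*} [CommRing R] {M : Submodule R (FractionRing R)}
    (hM : IsFracIdeal M) : IsFracIdeal (1 / M) := by
  obtain ⟨⟨u, hu⟩, y, hy, hyM⟩ := hM
  rw [smulQ_le_one_iff] at hyM
  refine ⟨⟨(IsLocalization.map_units (FractionRing R) (⟨y, hy⟩ : R⁰)).unit,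
    mem_one_div.2 hyM⟩, ?_⟩
  obtain ⟨r, hr, t, ht, h⟩ := exists_algebraMap_eq_of_isUnit u
  refine ⟨r, hr, (smulQ_le_one_iff _ _).2 fun m hm => ?_⟩
  obtain ⟨a, ha⟩ := mem_one_div.1 hm u hu
  exact ⟨t * a, by rw [map_mul, ha, ← h]; ring⟩

theorem isFracIdeal_idl {R : Type*} [CommRing R] {I : Ideal R} (hI : ∃ r ∈ I, r ∈ R⁰) :
    IsFracIdeal (idl R I) := by
  obtain ⟨r, hrI, hr⟩ := hI
  refine ⟨⟨(IsLocalization.map_units (FractionRing R) (⟨r, hr⟩ : R⁰)).unit, r, hrI, rfl⟩,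
    1, one_mem _, (smulQ_le_one_iff _ _).2 ?_⟩
  rintro _ ⟨i, -, rfl⟩
  exact ⟨i, by simp⟩

theorem isFracIdeal_condC {R : Type*} [CommRing R]
    (hfin : (Subalgebra.toSubmodule (integralClosure R (FractionRing R))).FG) :
    IsFracIdeal (condC R) := by
  refine isFracIdeal_one_div ⟨⟨1, (integralClosure R (FractionRing R)).one_mem⟩, ?_⟩
  obtain ⟨a, ha, h⟩ := FractionalIdeal.isFractional_of_fg (S := R⁰) hfin
  refine ⟨a, ha, (smulQ_le_one_iff _ _).2 fun m hm => ?_⟩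
  obtain ⟨r, hr⟩ := h m hm
  exact ⟨r, by rw [hr, Algebra.smul_def]⟩

theorem exists_mem_nonZeroDivisors_of_condC_le {R : Type*} [CommRing R]
    (hfin : (Subalgebra.toSubmodule (integralClosure R (FractionRing R))).FG)
    {I : Ideal R} (hI : condC R ≤ idl R I) : ∃ r ∈ I, r ∈ R⁰ := by
  obtain ⟨⟨u, hu⟩, -⟩ := isFracIdeal_condC hfin
  obtain ⟨r, hr, h⟩ := hI hu
  refine ⟨r, hr, mem_nonZeroDivisors_of_injective
    (IsFractionRing.injective R (FractionRing R)) ?_⟩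
  rw [show algebraMap R (FractionRing R) r = u from h]
  exact u.isUnit.mem_nonZeroDivisors

theorem IsIntegralOverIdeal.of_isIntegral {R : Type*} [CommRing R] {I : Ideal R} {x r : R}
    (hx : x ∈ I) {f : FractionRing R} (hf : IsIntegral R f)
    (h : algebraMap R (FractionRing R) r = f * algebraMap R (FractionRing R) x) :
    IsIntegralOverIdeal I r := by
  obtain ⟨p, hp, hroot⟩ := hf
  refine ⟨p.scaleRoots x, (Polynomial.monic_scaleRoots_iff x).2 hp, fun i _ => ?_, ?_⟩
  · rw [Polynomial.coeff_scaleRoots, Polynomial.natDegree_scaleRoots]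
    exact Ideal.mul_mem_left _ _ (Ideal.pow_mem_pow hx _)
  · apply IsFractionRing.injective R (FractionRing R)
    have := Polynomial.scaleRoots_eval₂_eq_zero (algebraMap R (FractionRing R)) (s := x) hroot
    rw [map_zero, ← Polynomial.eval₂_at_apply, h, mul_comm]
    exact this

theorem isIntegral_of_monic_of_isIntegral_coeff {R Q : Type*} [CommRing R] [CommRing Q]
    [Algebra R Q] (p : Polynomial Q) (hp : p.Monic) (hcoeff : ∀ i, IsIntegral R (p.coeff i))
    (q : Q) (hq : p.eval q = 0) : IsIntegral R q := by
  have hl : p ∈ Polynomial.lifts (algebraMap (integralClosure R Q) Q) := by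
    rw [Polynomial.lifts_iff_coeff_lifts]
    exact fun i => ⟨⟨p.coeff i, hcoeff i⟩, rfl⟩
  obtain ⟨p', hp', -, hm⟩ := Polynomial.lifts_and_natDegree_eq_and_monic hl hp
  refine isIntegral_trans (A := integralClosure R Q) q ⟨p', hm, ?_⟩
  rw [← Polynomial.eval_map, hp', hq]

theorem IsIntegralOverIdeal.isIntegral_mul {R Q : Type*} [CommRing R] [CommRing Q]
    [Algebra R Q] {I : Ideal R} {r : R} (hr : IsIntegralOverIdeal I r) (x : Q)
    (hx : ∀ i ∈ I, IsIntegral R (x * algebraMap R Q i)) :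
    IsIntegral R (x * algebraMap R Q r) := by
  have hpow : ∀ n : ℕ, ∀ i ∈ I ^ n, IsIntegral R (x ^ n * algebraMap R Q i) := by
    intro n
    induction n with
    | zero => intro i _; simpa using isIntegral_algebraMap
    | succ n ih =>
      intro i hi
      rw [pow_succ] at hi
      induction hi using Submodule.mul_induction_on' with
      | mem_mul_mem a ha b hb =>
        have := (ih a ha).mul (hx b hb)
        convert this using 1
        rw [map_mul]; ring
      | add a _ b _ h1 h2 => rw [map_add, mul_add]; exact h1.add h2
  obtain ⟨p, hp, hcoeff, hroot⟩ := hr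
  nontriviality Q
  refine isIntegral_of_monic_of_isIntegral_coeff ((p.map (algebraMap R Q)).scaleRoots x)
    ((Polynomial.monic_scaleRoots_iff x).2 (hp.map _)) (fun i => ?_) _ ?_
  · rw [Polynomial.coeff_scaleRoots, hp.natDegree_map, Polynomial.coeff_map, mul_comm]
    rcases lt_trichotomy i p.natDegree with h | h | h
    · exact hpow _ _ (hcoeff i h)
    · rw [h, Nat.sub_self, pow_zero, one_mul]; exact isIntegral_algebraMap
    · rw [Polynomial.coeff_eq_zero_of_natDegree_lt h, map_zero, mul_zero]; exact isIntegral_zero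
  · rw [Polynomial.scaleRoots_eval_mul, Polynomial.eval_map, Polynomial.eval₂_at_apply, hroot,
      map_zero, mul_zero]

theorem IsIntegralOverIdeal.mono {R : Type*} [CommRing R] {I J : Ideal R} (h : I ≤ J) {r : R}
    (hr : IsIntegralOverIdeal I r) : IsIntegralOverIdeal J r := by
  obtain ⟨p, hp, hc, h0⟩ := hr
  exact ⟨p, hp, fun i hi => Ideal.pow_right_mono h _ (hc i hi), h0⟩

theorem Subalgebra.mem_of_isIntegral_of_inv_mem {R Q : Type*} [CommRing R] [CommRing Q]
    [Algebra R Q] (B : Subalgebra R Q) (u : Qˣ) (hu : IsIntegral R (u : Q))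
    (hinv : ((u⁻¹ : Qˣ) : Q) ∈ B) : (u : Q) ∈ B := by
  obtain ⟨p, hp, hroot⟩ := hu
  rw [hp.as_sum] at hroot
  simp only [Polynomial.eval₂_add, Polynomial.eval₂_pow, Polynomial.eval₂_X,
    Polynomial.eval₂_finsetSum, Polynomial.eval₂_mul, Polynomial.eval₂_C] at hroot
  rcases Nat.eq_zero_or_pos p.natDegree with h0 | hpos
  · rw [h0] at hroot
    have h1 : (1 : Q) = 0 := by simpa using hroot
    rw [← mul_one (u : Q), h1, mul_zero]; exact B.zero_mem
  · obtain ⟨n, hn⟩ : ∃ n, p.natDegree = n + 1 := ⟨p.natDegree - 1, by omega⟩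
    rw [hn] at hroot
    have key : (u : Q) = -∑ i ∈ Finset.range (n + 1),
        algebraMap R Q (p.coeff i) * ((u⁻¹ : Qˣ) : Q) ^ (n - i) := by
      have h := congrArg (· * ((u⁻¹ : Qˣ) : Q) ^ n) hroot
      simp only [add_mul, Finset.sum_mul, zero_mul] at h
      rw [pow_succ', mul_assoc, ← mul_pow, Units.mul_inv, one_pow, mul_one] at h
      rw [eq_neg_iff_add_eq_zero, ← h]
      congr 1
      refine Finset.sum_congr rfl fun i hi => ?_
      obtain ⟨k, rfl⟩ := Nat.exists_eq_add_of_le (Nat.lt_succ_iff.1 (Finset.mem_range.1 hi))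
      rw [Nat.add_sub_cancel_left, mul_assoc, pow_add, ← mul_assoc ((u : Q) ^ i), ← mul_pow,
        Units.mul_inv, one_pow, one_mul]
    rw [key]
    exact B.neg_mem (B.sum_mem fun i _ => B.mul_mem (B.algebraMap_mem _) (B.pow_mem hinv _))

theorem isIntegral_of_mem_one_div_condC {R : Type*} [CommRing R] [IsNoetherianRing R]
    [IsLocalRing R] (hdim : ringKrullDim R = 1) [Infinite (IsLocalRing.ResidueField R)]
    (hfin : (Subalgebra.toSubmodule (integralClosure R (FractionRing R))).FG)
    {f : FractionRing R} (hf : f ∈ 1 / condC R) : IsIntegral R f := by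
  obtain ⟨c, hc, h⟩ := exists_unit_mem_forall_isIntegral hdim hfin _ (isFracIdeal_condC hfin)
  have hfc : f * c ∈ condC R := by
    refine mem_one_div.2 fun s hs => ?_
    have hcs : (c : FractionRing R) * s ∈ condC R := by
      refine mem_one_div.2 fun t ht => ?_
      rw [mul_assoc]
      exact mem_one_div.1 hc _ ((integralClosure R (FractionRing R)).mul_mem hs ht)
    rw [mul_assoc]
    exact mem_one_div.1 hf _ hcs
  have := h _ hfc
  rwa [mul_comm f, Units.inv_mul_cancel_left] at this

theorem one_div_le_one_div_of_le_submodule {R : Type*} [CommRing R]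
    {M N : Submodule R (FractionRing R)}
    (h : M ≤ N) : 1 / N ≤ 1 / M := fun _ hq =>
  mem_one_div.2 fun m hm => mem_one_div.1 hq m (h hm)

theorem one_div_smulQ {R : Type*} [CommRing R] (u : (FractionRing R)ˣ)
    (M : Submodule R (FractionRing R)) :
    1 / smulQ (u : FractionRing R) M =
      smulQ ((u⁻¹ : (FractionRing R)ˣ) : FractionRing R) (1 / M) := by
  ext q
  constructor
  · intro hq
    refine mem_smulQ.2 ⟨u * q, mem_one_div.2 fun m hm => ?_, by simp⟩
    obtain ⟨r, hr⟩ := mem_one_div.1 hq (u * m) (mem_smulQ.2 ⟨m, hm, rfl⟩)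
    exact ⟨r, by rw [hr]; ring⟩
  · intro hq
    obtain ⟨q', hq', rfl⟩ := mem_smulQ.1 hq
    refine mem_one_div.2 fun z hz => ?_
    obtain ⟨m, hm, rfl⟩ := mem_smulQ.1 hz
    obtain ⟨r, hr⟩ := mem_one_div.1 hq' m hm
    refine ⟨r, ?_⟩
    rw [hr, mul_mul_mul_comm, Units.inv_mul, one_mul]

theorem smulQ_inv_smulQ {R : Type*} [CommRing R] (u : (FractionRing R)ˣ)
    (M : Submodule R (FractionRing R)) :
    smulQ ((u⁻¹ : (FractionRing R)ˣ) : FractionRing R) (smulQ (u : FractionRing R) M) = M := by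
  rw [smulQ, smulQ, ← mul_assoc, Submodule.span_mul_span, Set.singleton_mul_singleton,
    Units.inv_mul, ← Submodule.one_eq_span, one_mul]

/-- The elements of `R` lying in `x R̄`, as an ideal. -/
def contractedIdeal {R : Type*} [CommRing R] (x : (FractionRing R)ˣ) : Ideal R where
  carrier := {r | IsIntegral R
    (((x⁻¹ : (FractionRing R)ˣ) : FractionRing R) * algebraMap R (FractionRing R) r)}
  zero_mem' := by simpa using isIntegral_zero
  add_mem' := by
    intro a b ha hb
    change IsIntegral R _
    rw [map_add, mul_add]
    exact IsIntegral.add ha hb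
  smul_mem' := by
    intro r a ha
    change IsIntegral R _
    rw [smul_eq_mul, map_mul, mul_left_comm]
    exact isIntegral_algebraMap.mul ha

theorem isIntegralOverIdeal_mem_of_stable {R : Type*} [CommRing R] [IsNoetherianRing R]
    [IsLocalRing R] (hdim : ringKrullDim R = 1) [Infinite (IsLocalRing.ResidueField R)]
    (hfin : (Subalgebra.toSubmodule (integralClosure R (FractionRing R))).FG)
    (hArf : ∀ I : Ideal R, (∃ r ∈ I, r ∈ R⁰) →
        (∀ r : R, IsIntegralOverIdeal I r → r ∈ I) →
        ∃ x ∈ I, Ideal.span {x} * I = I ^ 2)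
    (I : Ideal R) (hreg : ∃ r ∈ I, r ∈ R⁰) (hC : condC R ≤ idl R I)
    (hrefl : (1 : Submodule R (FractionRing R)) / (1 / idl R I) = idl R I)
    (r : R) (hr : IsIntegralOverIdeal I r) : r ∈ I := by
  obtain ⟨x, hxI, hx⟩ := exists_unit_mem_forall_isIntegral hdim hfin _ (isFracIdeal_idl hreg)
  set K : Ideal R := contractedIdeal x with hK
  have hIK : I ≤ K := fun i hi => hx _ ⟨i, hi, rfl⟩
  obtain ⟨w, hw, hwK⟩ := hArf K (hreg.imp fun a ha => ⟨hIK ha.1, ha.2⟩)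
    fun a ha => ha.isIntegral_mul _ fun i hi => hi
  have hmul : ∀ a ∈ K, ∀ b ∈ K, ∃ c ∈ K, w * c = a * b := fun a ha b hb => by
    have : a * b ∈ Ideal.span {w} * K := by
      rw [hwK, pow_two]; exact Ideal.mul_mem_mul ha hb
    exact Ideal.mem_span_singleton_mul.1 this
  obtain ⟨x₀, hx₀, hx₀x⟩ := hxI
  replace hx₀x : algebraMap R (FractionRing R) x₀ = x := hx₀x
  obtain ⟨i, -, hi⟩ := hmul x₀ (hIK hx₀) x₀ (hIK hx₀)
  have hwu : IsUnit (algebraMap R (FractionRing R) w) := by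
    apply isUnit_of_mul_isUnit_left (y := algebraMap R (FractionRing R) i)
    rw [← map_mul, hi, map_mul, hx₀x]
    exact x.isUnit.mul x.isUnit
  obtain ⟨v, hv⟩ := hwu
  let B : Subalgebra R (FractionRing R) :=
    { carrier := {q | (v : FractionRing R) * q ∈ idl R K}
      mul_mem' := by
        rintro a b ⟨a', ha', ea⟩ ⟨b', hb', eb⟩
        obtain ⟨c, hc, e⟩ := hmul a' ha' b' hb'
        refine ⟨c, hc, ?_⟩
        rw [Algebra.linearMap_apply] at ea eb ⊢
        have := congrArg (algebraMap R (FractionRing R)) e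
        rw [map_mul, map_mul, ea, eb, ← hv, mul_assoc, Units.mul_right_inj] at this
        rw [this]; ring
      add_mem' := by
        intro a b ha hb
        change (v : FractionRing R) * (a + b) ∈ idl R K
        rw [mul_add]; exact Submodule.add_mem _ ha hb
      algebraMap_mem' := fun a =>
        ⟨w * a, K.mul_mem_right a hw, by rw [Algebra.linearMap_apply, map_mul, hv]⟩ }
  have hs : ((x⁻¹ * v : (FractionRing R)ˣ) : FractionRing R) ∈ B := by
    refine B.mem_of_isIntegral_of_inv_mem _ ?_ ?_
    · rw [Units.val_mul, hv]; exact hw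
    · refine ⟨x₀, hIK hx₀, ?_⟩
      rw [Algebra.linearMap_apply, hx₀x, mul_inv_rev, inv_inv, Units.val_mul,
        Units.mul_inv_cancel_left]
  rw [← algebraMap_mem_idl, ← hrefl]
  refine mem_one_div.2 fun j hj => ?_
  have hrK : r ∈ K := (hr.mono hIK).isIntegral_mul _ fun i hi => hi
  obtain ⟨a, ha⟩ := mem_one_div.1 hj x ⟨x₀, hx₀, hx₀x⟩
  have haK : a ∈ K := by
    change IsIntegral R _
    rw [ha, mul_comm j, Units.inv_mul_cancel_left]
    exact isIntegral_of_mem_one_div_condC hdim hfin (one_div_le_one_div_of_le_submodule hC hj)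
  obtain ⟨c, hc, e⟩ := hmul a haK r hrK
  have hcB : ((v⁻¹ : (FractionRing R)ˣ) : FractionRing R) * algebraMap R _ c ∈ B :=
    ⟨c, hc, by simp⟩
  obtain ⟨d, -, hd⟩ := B.mul_mem hs hcB
  refine ⟨d, ?_⟩
  rw [Algebra.linearMap_apply] at hd
  have e' := congrArg (algebraMap R (FractionRing R)) e
  rw [map_mul, map_mul, ha, ← hv] at e'
  rw [hd, Units.val_mul]
  calc _ = ((x⁻¹ : (FractionRing R)ˣ) : FractionRing R) * (v * algebraMap R _ c) *
        (v * ((v⁻¹ : (FractionRing R)ˣ) : FractionRing R)) := by ring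
    _ = algebraMap R _ r * j * (x * ((x⁻¹ : (FractionRing R)ˣ) : FractionRing R)) := by
      rw [e', Units.mul_inv]; ring
    _ = _ := by rw [Units.mul_inv, mul_one]

theorem exists_integrallyClosed_smulQ_eq {R : Type*} [CommRing R] [IsNoetherianRing R]
    [IsLocalRing R] (hdim : ringKrullDim R = 1) [Infinite (IsLocalRing.ResidueField R)]
    (hfin : (Subalgebra.toSubmodule (integralClosure R (FractionRing R))).FG)
    (h : ∀ I : Ideal R, (∃ r ∈ I, r ∈ R⁰) →
        condC R ≤ idl R I →
        ((1 : Submodule R (FractionRing R)) / (1 / idl R I) = idl R I) →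
        ∀ r : R, IsIntegralOverIdeal I r → r ∈ I)
    (F : Submodule R (FractionRing R)) (hF : IsFracIdeal F)
    (hrefl : (1 : Submodule R (FractionRing R)) / (1 / F) = F) :
    ∃ (I : Ideal R) (u : (FractionRing R)ˣ),
      (∀ r : R, IsIntegralOverIdeal I r → r ∈ I) ∧
      condC R ≤ idl R I ∧ idl R I ≤ 1 ∧
      smulQ (u : FractionRing R) F = idl R I := by
  obtain ⟨z, hz, hzint⟩ :=
    exists_unit_mem_forall_isIntegral hdim hfin _ (isFracIdeal_one_div hF)
  set I : Ideal R := (smulQ (z : FractionRing R) F).comap (Algebra.linearMap R _) with hI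
  have hle : smulQ (z : FractionRing R) F ≤ 1 := (smulQ_le_one_iff _ _).2 (mem_one_div.1 hz)
  have hidl : idl R I = smulQ (z : FractionRing R) F := by
    rw [idl, hI, Submodule.map_comap_eq, ← Submodule.one_eq_range]
    exact inf_eq_right.2 hle
  have hC : condC R ≤ idl R I := by
    intro c hc
    rw [hidl]
    refine mem_smulQ.2 ⟨((z⁻¹ : (FractionRing R)ˣ) : FractionRing R) * c, ?_, by simp⟩
    rw [← hrefl]
    refine mem_one_div.2 fun g hg => ?_
    obtain ⟨r, hr⟩ := mem_one_div.1 hc _ (hzint g hg)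
    exact ⟨r, by rw [hr]; ring⟩
  refine ⟨I, z, h I (exists_mem_nonZeroDivisors_of_condC_le hfin hC) hC ?_, hC,
    hidl ▸ hle, hidl.symm⟩
  rw [hidl, one_div_smulQ, one_div_smulQ, inv_inv, hrefl]

theorem mul_mem_one_div_of_integrallyClosed {R : Type*} [CommRing R] {J : Ideal R}
    (hJ : ∀ r : R, IsIntegralOverIdeal J r → r ∈ J) {f g : FractionRing R}
    (hfint : IsIntegral R f) (hf : f ∈ 1 / idl R J) (hg : g ∈ 1 / idl R J) :
    g * f ∈ 1 / idl R J := by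
  refine mem_one_div.2 ?_
  rintro _ ⟨j, hj, rfl⟩
  obtain ⟨r, hr⟩ := mem_one_div.1 hf _ ⟨j, hj, rfl⟩
  obtain ⟨t, ht⟩ := mem_one_div.1 hg _ ⟨r, hJ r (.of_isIntegral hj hfint hr), rfl⟩
  exact ⟨t, by rw [ht, Algebra.linearMap_apply, hr, mul_assoc]⟩

theorem exists_span_mul_eq_sq_of_isomorphic {R : Type*} [CommRing R] [IsNoetherianRing R]
    [IsLocalRing R] (hdim : ringKrullDim R = 1) [Infinite (IsLocalRing.ResidueField R)]
    (hfin : (Subalgebra.toSubmodule (integralClosure R (FractionRing R))).FG)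
    (h : ∀ F : Submodule R (FractionRing R), IsFracIdeal F →
        ((1 : Submodule R (FractionRing R)) / (1 / F) = F) →
        ∃ (I : Ideal R) (u : (FractionRing R)ˣ),
          (∀ r : R, IsIntegralOverIdeal I r → r ∈ I) ∧
          condC R ≤ idl R I ∧ idl R I ≤ 1 ∧
          smulQ (u : FractionRing R) F = idl R I)
    (I : Ideal R) (hreg : ∃ r ∈ I, r ∈ R⁰) (hI : ∀ r : R, IsIntegralOverIdeal I r → r ∈ I) :
    ∃ x ∈ I, Ideal.span {x} * I = I ^ 2 := by
  have hfrac := isFracIdeal_idl hreg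
  obtain ⟨x, ⟨x₀, hx₀, hx₀x⟩, hx⟩ := exists_unit_mem_forall_isIntegral hdim hfin _ hfrac
  rw [Algebra.linearMap_apply] at hx₀x
  have hrefl : (1 : Submodule R (FractionRing R)) / (1 / idl R I) = idl R I := by
    apply le_antisymm
    · intro y hy
      obtain ⟨r, hr⟩ := mem_one_div.1 hy 1
        (mem_one_div.2 fun _ ⟨i, _, e⟩ => ⟨i, by rw [one_mul]; exact e⟩)
      rw [mul_one] at hr
      rw [← hr, algebraMap_mem_idl]
      refine hI r (.of_isIntegral hx₀ (f := ((x⁻¹ : (FractionRing R)ˣ) : FractionRing R) * y) ?_ ?_)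
      · apply isIntegral_of_mem_one_div_condC hdim hfin
        refine mem_one_div.2 fun c hc => ?_
        obtain ⟨t, ht⟩ := mem_one_div.1 hy (((x⁻¹ : (FractionRing R)ˣ) : FractionRing R) * c)
          (mem_one_div.2 fun i hi => by
            obtain ⟨t, ht⟩ := mem_one_div.1 hc _ (hx i hi)
            exact ⟨t, by rw [ht]; ring⟩)
        exact ⟨t, by rw [ht]; ring⟩
      · rw [hr, hx₀x, mul_comm, Units.mul_inv_cancel_left]
    · intro y hy
      refine mem_one_div.2 fun g hg => ?_
      rw [mul_comm]
      exact mem_one_div.1 hg y hy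
  obtain ⟨J, u, hJ, hC, -, hJu⟩ := h (1 / idl R I) (isFracIdeal_one_div hfrac) (by rw [hrefl])
  have hIJ : idl R I = smulQ (u : FractionRing R) (1 / idl R J) := by
    rw [← hJu, one_div_smulQ, hrefl]
    simpa using (smulQ_inv_smulQ u⁻¹ (idl R I)).symm
  have hone : (1 : FractionRing R) ∈ 1 / idl R J :=
    mem_one_div.2 fun _ ⟨i, _, e⟩ => ⟨i, by rw [one_mul]; exact e⟩
  obtain ⟨v, hv, hvu⟩ : (u : FractionRing R) ∈ idl R I := by
    rw [hIJ]; exact mem_smulQ.2 ⟨1, hone, mul_one _⟩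
  refine ⟨v, hv, le_antisymm ?_ ?_⟩
  · rw [pow_two]
    exact Ideal.mul_mono_left ((Ideal.span_singleton_le_iff_mem _).2 hv)
  · rw [pow_two, Ideal.mul_le]
    intro a ha b hb
    obtain ⟨f, hf, ef⟩ := mem_smulQ.1 (hIJ ▸ algebraMap_mem_idl.2 ha)
    obtain ⟨g, hg, eg⟩ := mem_smulQ.1 (hIJ ▸ algebraMap_mem_idl.2 hb)
    have hmem : (u : FractionRing R) * (g * f) ∈ idl R I := by
      rw [hIJ]
      exact mem_smulQ.2 ⟨_, mul_mem_one_div_of_integrallyClosed hJ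
        (isIntegral_of_mem_one_div_condC hdim hfin (one_div_le_one_div_of_le_submodule hC hf)) hf hg, rfl⟩
    obtain ⟨c, hc, e⟩ := hmem
    refine Ideal.mem_span_singleton_mul.2 ⟨c, hc, ?_⟩
    apply IsFractionRing.injective R (FractionRing R)
    rw [Algebra.linearMap_apply] at e hvu
    rw [map_mul, map_mul, e, hvu, ← ef, ← eg]; ring

theorem statement_19
    (R : Type*) [CommRing R] [IsNoetherianRing R] [IsLocalRing R] [IsReduced R]
    (hdim : ringKrullDim R = 1)
    (hCM : ∃ x ∈ IsLocalRing.maximalIdeal R, x ∈ R⁰)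
    [Infinite (IsLocalRing.ResidueField R)]
    (hfin : (Subalgebra.toSubmodule (integralClosure R (FractionRing R))).FG)
    :
    ((∀ I : Ideal R, (∃ r ∈ I, r ∈ R⁰) →
        (∀ r : R, IsIntegralOverIdeal I r → r ∈ I) →
        ∃ x ∈ I, Ideal.span {x} * I = I ^ 2) ↔
      (∀ I : Ideal R, (∃ r ∈ I, r ∈ R⁰) →
        condC R ≤ idl R I →
        ((1 : Submodule R (FractionRing R)) / (1 / idl R I) = idl R I) →
        ∀ r : R, IsIntegralOverIdeal I r → r ∈ I)) ∧
    ((∀ I : Ideal R, (∃ r ∈ I, r ∈ R⁰) →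
        (∀ r : R, IsIntegralOverIdeal I r → r ∈ I) →
        ∃ x ∈ I, Ideal.span {x} * I = I ^ 2) ↔
      (∀ F : Submodule R (FractionRing R), IsFracIdeal F →
        ((1 : Submodule R (FractionRing R)) / (1 / F) = F) →
        ∃ (I : Ideal R) (u : (FractionRing R)ˣ),
          (∀ r : R, IsIntegralOverIdeal I r → r ∈ I) ∧
          condC R ≤ idl R I ∧ idl R I ≤ 1 ∧
          smulQ (u : FractionRing R) F = idl R I)) := by
  have h₁₂ := isIntegralOverIdeal_mem_of_stable (R := R) hdim hfin
  have h₂₃ := exists_integrallyClosed_smulQ_eq (R := R) hdim hfin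
  have h₃₁ := exists_span_mul_eq_sq_of_isomorphic (R := R) hdim hfin
  exact ⟨⟨h₁₂, fun h => h₃₁ (h₂₃ h)⟩, ⟨fun h => h₂₃ (h₁₂ h), h₃₁⟩⟩
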